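/- Let M ⊆ ℝ^d, let f : [M] → ℝ^d be an additive group homomorphism whose image f(M) is untied, and let F : ℝ^d → ℝ^d be an ℝ-linear map such that ‖F(x) − f(x)‖ is uniformly bounded over x ∈ M. Then F is surjective, and hence a linear isomorphism of ℝ^d. -/

import Mathlib

open scoped Pointwise

/-- `S` is tied if it lies within bounded distance of a `(d-1)`-dimensional
linear subspace of `ℝ^d`. -/
def Tied {d : ℕ} (S : Set (EuclideanSpace ℝ (Fin d))) : Prop :=
  ∃ H : Submodule ℝ (EuclideanSpace ℝ (Fin d)), Module.finrank ℝ H = d - 1 ∧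
    ∃ r > (0 : ℝ), S ⊆ (H : Set (EuclideanSpace ℝ (Fin d))) + Metric.closedBall 0 r

/-- The image of the part of `T` lying in `[M]` under a homomorphism defined on `[M]`. -/
def homImage {d m : ℕ} {M : Set (EuclideanSpace ℝ (Fin d))}
    (f : (AddSubgroup.closure M) →+ EuclideanSpace ℝ (Fin m))
    (T : Set (EuclideanSpace ℝ (Fin d))) : Set (EuclideanSpace ℝ (Fin m)) :=
  f '' {x : AddSubgroup.closure M | (x : EuclideanSpace ℝ (Fin d)) ∈ T}

/-- If `f(M)` is untied and `F` is a linear map uniformly approximating `f` on `M`,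
then `F` is surjective, hence a linear isomorphism of `ℝ^d`. -/
theorem associated_linear_map_surjective {d : ℕ} (M : Set (EuclideanSpace ℝ (Fin d)))
    (f : (AddSubgroup.closure M) →+ EuclideanSpace ℝ (Fin d))
    (huntied : ¬ Tied (homImage f M))
    (F : EuclideanSpace ℝ (Fin d) →ₗ[ℝ] EuclideanSpace ℝ (Fin d)) (C : ℝ)
    (hFf : ∀ (x : EuclideanSpace ℝ (Fin d)) (hx : x ∈ M),
      ‖F x - f ⟨x, AddSubgroup.subset_closure hx⟩‖ ≤ C) :
    Function.Surjective F ∧ Function.Bijective F := by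
  suffices hsurj : Function.Surjective F from
    ⟨hsurj, LinearMap.injective_iff_surjective.mpr hsurj, hsurj⟩
  by_contra hF
  have hlt : LinearMap.range F < ⊤ :=
    lt_top_iff_ne_top.mpr fun h => hF (LinearMap.range_eq_top.mp h)
  obtain ⟨φ, hφ, hle⟩ := Submodule.exists_le_ker_of_lt_top _ hlt
  have hrank := Module.Dual.finrank_ker_add_one_of_ne_zero hφ
  rw [finrank_euclideanSpace_fin] at hrank
  refine huntied ⟨LinearMap.ker φ, by omega, max C 1, by positivity, ?_⟩
  rintro _ ⟨x, hx, rfl⟩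
  refine Set.mem_add.mpr ⟨F x, hle ⟨x, rfl⟩, f x - F x, ?_, by abel⟩
  rw [mem_closedBall_zero_iff, norm_sub_rev]
  exact (hFf x hx).trans (le_max_left C 1)
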